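/- Let A be an associative unital ℂ-algebra (not necessarily commutative), X an n×n matrix over A, χ the character of a finite-dimensional irreducible complex representation of S_p, and g ∈ GL_n(ℂ). Let gXg⁻¹ denote the n×n matrix over A with entries (gXg⁻¹)_{ij} = Σ_{k,l} g_{ik} (g⁻¹)_{lj} X_{kl}. Then imm_{χ,p}(gXg⁻¹) = imm_{χ,p} X, where imm_{χ,p} X = (1/p!) Σ_{I∈{1,…,n}^p} symm-imm_χ X_{II}. -/

import Mathlib

open CategoryTheory

/-- symmetrized immanant:
`(1/p!) Σ_{σ,σ'∈S_p} χ(σσ'⁻¹) X_{σ(1),σ'(1)} ⋯ X_{σ(p),σ'(p)}`. -/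
noncomputable def symmImm {p : ℕ} {A : Type*} [Ring A] [Algebra ℂ A]
    (χ : Equiv.Perm (Fin p) → ℂ) (X : Matrix (Fin p) (Fin p) A) : A :=
  ∑ σ : Equiv.Perm (Fin p), ∑ σ' : Equiv.Perm (Fin p),
    ((p.factorial : ℂ)⁻¹ * χ (σ * σ'⁻¹)) •
      (List.ofFn fun a : Fin p => X (σ a) (σ' a)).prod

/-- `imm_{χ,p} X = (1/p!) Σ_{I∈[n]^p} symm-imm_χ X_{II}`. -/
noncomputable def immP (p : ℕ) {n : ℕ} {A : Type*} [Ring A] [Algebra ℂ A]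
    (χ : Equiv.Perm (Fin p) → ℂ) (X : Matrix (Fin n) (Fin n) A) : A :=
  ((p.factorial : ℂ))⁻¹ • ∑ I : Fin p → Fin n, symmImm χ (X.submatrix I I)

/-- The matrix `gXg⁻¹` with entries `Σ_{k,l} g_{ik} (g⁻¹)_{lj} • X_{kl}`. -/
noncomputable def conjMat {n : ℕ} {A : Type*} [Ring A] [Algebra ℂ A]
    (g : Matrix.GeneralLinearGroup (Fin n) ℂ) (X : Matrix (Fin n) (Fin n) A) :
    Matrix (Fin n) (Fin n) A :=
  Matrix.of fun i j => ∑ k : Fin n, ∑ l : Fin n,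
    ((g : Matrix (Fin n) (Fin n) ℂ) i k * ((g⁻¹ : Matrix.GeneralLinearGroup (Fin n) ℂ) :
      Matrix (Fin n) (Fin n) ℂ) l j) • X k l

/-- Expansion of an ordered product of linear combinations of the entries of `X`. -/
theorem prod_ofFn_sum_sum_smul {R A ι κ : Type*} [CommRing R] [Ring A] [Algebra R A]
    [Fintype ι] [Fintype κ] {p : ℕ} (c : Fin p → ι → κ → R) (X : ι → κ → A) :
    (List.ofFn fun a => ∑ k, ∑ l, c a k l • X k l).prod =
      ∑ K : Fin p → ι, ∑ L : Fin p → κ,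
        (∏ a, c a (K a) (L a)) • (List.ofFn fun a => X (K a) (L a)).prod := by
  classical
  have h := (MultilinearMap.mkPiAlgebraFin R p A).map_sum
    (fun a (kl : ι × κ) => c a kl.1 kl.2 • X kl.1 kl.2)
  simp only [MultilinearMap.map_smul_univ, MultilinearMap.mkPiAlgebraFin_apply,
    Fintype.sum_prod_type] at h
  rw [h, ← Fintype.sum_prod_type', ← (Equiv.arrowProdEquivProdArrow (Fin p) (fun _ => ι)
    (fun _ => κ)).sum_comp]
  rfl

/-- Summing over the index sequences, the matrices `g` and `g⁻¹` cancel. -/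
theorem sum_prod_mul_inv_comp {R ι α : Type*} [CommRing R] [Fintype ι] [DecidableEq ι]
    [Fintype α] [DecidableEq α] (g : Matrix.GeneralLinearGroup ι R) (σ τ : Equiv.Perm α)
    (K L : α → ι) :
    ∑ I : α → ι, ∏ a, (g.val (I (σ a)) (K a) * (g⁻¹).val (L a) (I (τ a))) =
      if L = K ∘ σ.symm ∘ τ then 1 else 0 := by
  have hg (k l : ι) : ∑ i, g.val i k * (g⁻¹).val l i = if l = k then 1 else 0 := by
    have h : (g⁻¹).val * g.val = 1 := g.inv_mul
    rw [← Matrix.one_apply, ← h, Matrix.mul_apply]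
    exact Finset.sum_congr rfl fun i _ => mul_comm _ _
  have hI (I : α → ι) : ∏ a, (g.val (I (σ a)) (K a) * (g⁻¹).val (L a) (I (τ a))) =
      ∏ a, (g.val (I a) (K (σ.symm a)) * (g⁻¹).val (L (τ.symm a)) (I a)) := by
    rw [Finset.prod_mul_distrib, Finset.prod_mul_distrib]
    congr 1
    · rw [← Equiv.prod_comp σ (fun a => g.val (I a) (K (σ.symm a)))]
      simp
    · rw [← Equiv.prod_comp τ (fun a => (g⁻¹).val (L (τ.symm a)) (I a))]
      simp
  simp only [hI]
  rw [← Fintype.prod_sum (fun a i => g.val i (K (σ.symm a)) * (g⁻¹).val (L (τ.symm a)) i)]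
  simp only [hg, Finset.prod_ite_zero, Finset.prod_const_one, Finset.mem_univ, true_imp_iff]
  refine if_congr ?_ rfl rfl
  constructor
  · intro h
    funext a
    simpa using h (τ a)
  · rintro rfl a
    simp

theorem sum_prod_ofFn_conjMat {p n : ℕ} {A : Type*} [Ring A] [Algebra ℂ A]
    (g : Matrix.GeneralLinearGroup (Fin n) ℂ) (X : Matrix (Fin n) (Fin n) A)
    (σ τ : Equiv.Perm (Fin p)) :
    ∑ I : Fin p → Fin n, (List.ofFn fun a => conjMat g X (I (σ a)) (I (τ a))).prod =
      ∑ I : Fin p → Fin n, (List.ofFn fun a => X (I (σ a)) (I (τ a))).prod := by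
  simp only [conjMat, Matrix.of_apply]
  simp_rw [prod_ofFn_sum_sum_smul (fun a k l => g.val _ k * (g⁻¹).val l _) X]
  rw [Finset.sum_comm, ← (σ.symm.arrowCongr (Equiv.refl (Fin n))).sum_comp]
  refine Finset.sum_congr rfl fun K _ => ?_
  rw [Finset.sum_comm]
  simp only [← Finset.sum_smul, sum_prod_mul_inv_comp, ite_smul, one_smul, zero_smul,
    Finset.sum_ite_eq', Finset.mem_univ, if_true]
  simp [Equiv.arrowCongr]

/-- For an arbitrary function `χ` on `S_p`, `imm_{χ,p}` is invariant under conjugation. -/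
theorem immP_conjMat {p n : ℕ} {A : Type*} [Ring A] [Algebra ℂ A]
    (χ : Equiv.Perm (Fin p) → ℂ) (g : Matrix.GeneralLinearGroup (Fin n) ℂ)
    (X : Matrix (Fin n) (Fin n) A) :
    immP p χ (conjMat g X) = immP p χ X := by
  have h (Y : Matrix (Fin n) (Fin n) A) : ∑ I : Fin p → Fin n, symmImm χ (Y.submatrix I I) =
      ∑ σ : Equiv.Perm (Fin p), ∑ τ : Equiv.Perm (Fin p),
        ((p.factorial : ℂ)⁻¹ * χ (σ * τ⁻¹)) •
          ∑ I : Fin p → Fin n, (List.ofFn fun a => Y (I (σ a)) (I (τ a))).prod := by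
    simp only [symmImm, Matrix.submatrix_apply]
    rw [Finset.sum_comm]
    refine Finset.sum_congr rfl fun σ _ => ?_
    rw [Finset.sum_comm]
    simp only [Finset.smul_sum]
  simp only [immP, h, sum_prod_ofFn_conjMat]

/-- For `χ` the character of a finite-dimensional irreducible complex representation of
`S_p`, `imm_{χ,p}` is invariant under conjugation by `g ∈ GL_n(ℂ)`. -/
theorem stmt8 {p n : ℕ} {A : Type*} [Ring A] [Algebra ℂ A]
    (W : FDRep ℂ (Equiv.Perm (Fin p))) [Simple W]
    (g : Matrix.GeneralLinearGroup (Fin n) ℂ) (X : Matrix (Fin n) (Fin n) A) :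
    immP p W.character (conjMat g X) = immP p W.character X :=
  immP_conjMat W.character g X
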